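/- Let H be a real Hilbert space, μ a positive Borel measure on [0,∞), and ω(t) = ∫_{[0,∞)} e^{−λt} dμ(λ) finite for every t > 0. Let u : [0,∞) → H be continuous and bounded, fix t > 0, define the Bochner integral A(t) = ∫_0^t ω(t−s) u(s) ds and the scalar integral B(t) = ∫_0^t ω(t−s) ‖u(s)‖² ds, and assume A and B are differentiable at t. Then ⟨u(t), A′(t)⟩ ≥ (1/2)·B′(t). -/

import Mathlib

open MeasureTheory Set RealInnerProductSpace

/-- The coefficients `b` with `w_0 / ∑ w_j z^j = 1 - w_0 ∑ b_j z^(j+1)` as formal power series. -/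
noncomputable def renewalCoeff (w : ℕ → ℝ) : ℕ → ℝ
  | m => (w (m + 1) / w 0 - ∑ j : Fin m, renewalCoeff w j * w (m - j)) / w 0

lemma renewalCoeff_conv {w : ℕ → ℝ} (hw : ∀ i, 0 < w i) (m : ℕ) :
    ∑ j ∈ Finset.range (m + 1), renewalCoeff w j * w (m - j) = w (m + 1) / w 0 := by
  have h0 := (hw 0).ne'
  rw [Finset.sum_range_succ, Nat.sub_self]
  conv_lhs => enter [2]; rw [renewalCoeff]
  rw [div_mul_cancel₀ _ h0,
    Fin.sum_univ_eq_sum_range (fun j => renewalCoeff w j * w (m - j)) m]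
  ring

lemma logConvex_mul_le {w : ℕ → ℝ} (hw : ∀ i, 0 < w i)
    (hlc : ∀ i, w (i + 1) ^ 2 ≤ w i * w (i + 2)) {i n : ℕ} (hin : i ≤ n) :
    w (i + 1) * w n ≤ w i * w (n + 1) := by
  induction n, hin using Nat.le_induction with
  | base => exact (mul_comm _ _).le
  | succ n hn ih =>
    have h1 := hlc n
    have h2 := hw n
    have h3 := hw (n + 1)
    have h4 := hw i
    have h5 := hw (i + 1)
    refine le_of_mul_le_mul_right ?_ h2
    calc w (i + 1) * w (n + 1) * w n = (w (i + 1) * w n) * w (n + 1) := by ring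
      _ ≤ (w i * w (n + 1)) * w (n + 1) := by gcongr
      _ = w i * w (n + 1) ^ 2 := by ring
      _ ≤ w i * (w n * w (n + 2)) := by gcongr
      _ = w i * w (n + 1 + 1) * w n := by ring

/-- Kaluza's theorem: the renewal coefficients of a log-convex sequence are nonnegative. -/
lemma renewalCoeff_nonneg {w : ℕ → ℝ} (hw : ∀ i, 0 < w i)
    (hlc : ∀ i, w (i + 1) ^ 2 ≤ w i * w (i + 2)) (m : ℕ) : 0 ≤ renewalCoeff w m := by
  induction m using Nat.strong_induction_on with
  | _ m ih =>
    rcases m with _ | m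
    · rw [renewalCoeff]
      have := hw 0
      have := hw 1
      simp
      positivity
    · have h0 := hw 0
      have hc := renewalCoeff_conv hw (m + 1)
      rw [Finset.sum_range_succ, Nat.sub_self] at hc
      have hc' := renewalCoeff_conv hw m
      have h1 := hw (m + 1)
      have key : ∑ j ∈ Finset.range (m + 1), renewalCoeff w j * w (m + 1 - j) ≤
          w (m + 1 + 1) / w 0 := by
        calc ∑ j ∈ Finset.range (m + 1), renewalCoeff w j * w (m + 1 - j)
            ≤ ∑ j ∈ Finset.range (m + 1),
              renewalCoeff w j * w (m - j) * (w (m + 1 + 1) / w (m + 1)) := by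
              refine Finset.sum_le_sum fun j hj => ?_
              have hj' := Finset.mem_range.1 hj
              rw [mul_assoc]
              refine mul_le_mul_of_nonneg_left ?_ (ih j hj')
              rw [← mul_div_assoc, le_div_iff₀ h1, Nat.sub_add_comm (by omega)]
              exact logConvex_mul_le hw hlc (by omega)
          _ = w (m + 1 + 1) / w 0 := by
              rw [← Finset.sum_mul, hc']
              field_simp
      have : 0 ≤ renewalCoeff w (m + 1) * w 0 := by linarith
      exact nonneg_of_mul_nonneg_left this h0

lemma sum_renewalCoeff_le {w : ℕ → ℝ} (hw : ∀ i, 0 < w i) (hanti : Antitone w)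
    (hlc : ∀ i, w (i + 1) ^ 2 ≤ w i * w (i + 2)) (n : ℕ) :
    ∑ j ∈ Finset.range n, renewalCoeff w j ≤ 1 / w 0 := by
  have h0 := hw 0
  rcases n with _ | m
  · simpa using h0.le
  refine le_of_mul_le_mul_right ?_ (hw m)
  calc (∑ j ∈ Finset.range (m + 1), renewalCoeff w j) * w m
      ≤ ∑ j ∈ Finset.range (m + 1), renewalCoeff w j * w (m - j) := by
        rw [Finset.sum_mul]
        exact Finset.sum_le_sum fun j _ => mul_le_mul_of_nonneg_left
          (hanti (Nat.sub_le _ _)) (renewalCoeff_nonneg hw hlc j)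
    _ = w (m + 1) / w 0 := renewalCoeff_conv hw m
    _ ≤ w m / w 0 := by gcongr; exact hanti (Nat.le_succ m)
    _ = 1 / w 0 * w m := by ring

/-- Tails of the renewal coefficients. -/
noncomputable def renewalTail (w : ℕ → ℝ) (n : ℕ) : ℝ :=
  1 / w 0 - ∑ j ∈ Finset.range n, renewalCoeff w j

lemma renewalTail_succ (w : ℕ → ℝ) (n : ℕ) :
    renewalTail w (n + 1) = renewalTail w n - renewalCoeff w n := by
  simp only [renewalTail, Finset.sum_range_succ]; ring

lemma renewalTail_antitone {w : ℕ → ℝ} (hw : ∀ i, 0 < w i)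
    (hlc : ∀ i, w (i + 1) ^ 2 ≤ w i * w (i + 2)) : Antitone (renewalTail w) :=
  antitone_nat_of_succ_le fun n => by
    rw [renewalTail_succ]; linarith [renewalCoeff_nonneg hw hlc n]

lemma renewalTail_nonneg {w : ℕ → ℝ} (hw : ∀ i, 0 < w i) (hanti : Antitone w)
    (hlc : ∀ i, w (i + 1) ^ 2 ≤ w i * w (i + 2)) (n : ℕ) : 0 ≤ renewalTail w n :=
  sub_nonneg.2 (sum_renewalCoeff_le hw hanti hlc n)

lemma renewalTail_conv {w : ℕ → ℝ} (hw : ∀ i, 0 < w i) (m : ℕ) :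
    ∑ i ∈ Finset.range (m + 1), renewalTail w i * w (m - i) = 1 := by
  have h0 := (hw 0).ne'
  induction m with
  | zero => simp [renewalTail, h0]
  | succ m ih =>
    rw [Finset.sum_range_succ']
    have h1 : ∀ i ∈ Finset.range (m + 1), renewalTail w (i + 1) * w (m + 1 - (i + 1)) =
        renewalTail w i * w (m - i) - renewalCoeff w i * w (m - i) := fun i _ => by
      rw [renewalTail_succ, Nat.add_sub_add_right]; ring
    rw [Finset.sum_congr rfl h1, Finset.sum_sub_distrib, ih, renewalCoeff_conv hw]
    simp [renewalTail]
    ring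

lemma renewalTail_mul_sum_le {w : ℕ → ℝ} (hw : ∀ i, 0 < w i)
    (hlc : ∀ i, w (i + 1) ^ 2 ≤ w i * w (i + 2)) (hanti : Antitone w) (n : ℕ) :
    renewalTail w n * ∑ l ∈ Finset.range n, w l ≤ 1 := by
  calc renewalTail w n * ∑ l ∈ Finset.range n, w l
      ≤ renewalTail w n * ∑ l ∈ Finset.range (n + 1), w l := by
        refine mul_le_mul_of_nonneg_left ?_ (renewalTail_nonneg hw hanti hlc n)
        rw [Finset.sum_range_succ]; linarith [hw n]
    _ = ∑ i ∈ Finset.range (n + 1), renewalTail w n * w (n - i) := by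
        rw [← Finset.mul_sum]
        congr 1
        simpa using (Finset.sum_range_reflect w (n + 1)).symm
    _ ≤ ∑ i ∈ Finset.range (n + 1), renewalTail w i * w (n - i) := by
        refine Finset.sum_le_sum fun i hi => mul_le_mul_of_nonneg_right
          (renewalTail_antitone hw hlc ?_) (hw _).le
        have := Finset.mem_range.1 hi
        omega
    _ = 1 := renewalTail_conv hw n

lemma le_sum_renewalTail_mul_sum {w : ℕ → ℝ} (hw : ∀ i, 0 < w i) (hanti : Antitone w)
    (hlc : ∀ i, w (i + 1) ^ 2 ≤ w i * w (i + 2)) (n : ℕ) :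
    (n : ℝ) ≤ (∑ i ∈ Finset.range n, renewalTail w i) * ∑ l ∈ Finset.range n, w l := by
  calc (n : ℝ) = ∑ m ∈ Finset.range n,
        ∑ i ∈ Finset.range (m + 1), renewalTail w i * w (m - i) := by
        simp [renewalTail_conv hw]
    _ = ∑ i ∈ Finset.range n, ∑ m ∈ Finset.Ico i n, renewalTail w i * w (m - i) :=
        Finset.sum_comm' fun x y => by simp only [Finset.mem_range, Finset.mem_Ico]; omega
    _ ≤ ∑ i ∈ Finset.range n, renewalTail w i * ∑ l ∈ Finset.range n, w l := by
        refine Finset.sum_le_sum fun i _ => ?_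
        rw [← Finset.mul_sum]
        refine mul_le_mul_of_nonneg_left ?_ (renewalTail_nonneg hw hanti hlc i)
        rw [Finset.sum_Ico_eq_sum_range]
        simp only [Nat.add_sub_cancel_left]
        exact Finset.sum_le_sum_of_subset_of_nonneg
          (Finset.range_mono (Nat.sub_le _ _)) fun j _ _ => (hw j).le
    _ = _ := by rw [Finset.sum_mul]

lemma sum_succ_mul_renewalCoeff (w : ℕ → ℝ) (n : ℕ) :
    ∑ j ∈ Finset.range n, ((j : ℝ) + 1) * renewalCoeff w j =
      ∑ i ∈ Finset.range n, renewalTail w i - n * renewalTail w n := by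
  induction n with
  | zero => simp
  | succ n ih =>
    rw [Finset.sum_range_succ, Finset.sum_range_succ, ih, renewalTail_succ]
    push_cast
    ring

lemma le_sum_succ_mul_renewalCoeff {w : ℕ → ℝ} (hw : ∀ i, 0 < w i) (hanti : Antitone w)
    (hlc : ∀ i, w (i + 1) ^ 2 ≤ w i * w (i + 2)) {m n : ℕ} (hm : 0 < m) (hmn : m ≤ n) :
    m * (1 / (∑ l ∈ Finset.range m, w l) - 1 / ∑ l ∈ Finset.range n, w l) ≤
      ∑ j ∈ Finset.range n, ((j : ℝ) + 1) * renewalCoeff w j := by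
  have hpos : ∀ k, 0 < k → 0 < ∑ l ∈ Finset.range k, w l := fun k hk =>
    Finset.sum_pos (fun i _ => hw i) (Finset.nonempty_range_iff.2 hk.ne')
  have h1 := le_sum_renewalTail_mul_sum hw hanti hlc m
  have h2 := renewalTail_mul_sum_le hw hlc hanti n
  rw [← div_le_iff₀ (hpos m hm)] at h1
  rw [← le_div_iff₀ (hpos n (hm.trans_le hmn))] at h2
  rw [sum_succ_mul_renewalCoeff]
  have h3 : ∑ i ∈ Finset.range m, (renewalTail w i - renewalTail w n) ≤
      ∑ i ∈ Finset.range n, (renewalTail w i - renewalTail w n) :=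
    Finset.sum_le_sum_of_subset_of_nonneg (Finset.range_mono hmn) fun j hj _ =>
      sub_nonneg.2 (renewalTail_antitone hw hlc (Finset.mem_range.1 hj).le)
  simp only [Finset.sum_sub_distrib, Finset.sum_const, Finset.card_range, nsmul_eq_mul] at h3
  have h4 : (m : ℝ) * renewalTail w n ≤ m * (1 / ∑ l ∈ Finset.range n, w l) := by gcongr
  rw [mul_sub, mul_one_div]
  linarith

lemma sum_range_conv_le {b e : ℕ → ℝ} (hb : ∀ i, 0 ≤ b i) (he : ∀ i, 0 ≤ e i) (n : ℕ) :
    ∑ m ∈ Finset.range n, ∑ j ∈ Finset.range m, b j * e (m - 1 - j) ≤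
      (∑ j ∈ Finset.range n, b j) * ∑ i ∈ Finset.range n, e i := by
  calc _ = ∑ j ∈ Finset.range n, ∑ m ∈ Finset.Ico (j + 1) n, b j * e (m - 1 - j) :=
        Finset.sum_comm' fun x y => by simp only [Finset.mem_range, Finset.mem_Ico]; omega
    _ ≤ ∑ j ∈ Finset.range n, b j * ∑ i ∈ Finset.range n, e i := by
        refine Finset.sum_le_sum fun j _ => ?_
        rw [← Finset.mul_sum]
        refine mul_le_mul_of_nonneg_left ?_ (hb j)
        rw [Finset.sum_Ico_eq_sum_range]
        have : ∀ k, j + 1 + k - 1 - j = k := fun k => by omega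
        simp only [this]
        exact Finset.sum_le_sum_of_subset_of_nonneg
          (Finset.range_mono (Nat.sub_le _ _)) fun j _ _ => he j
    _ = _ := by rw [Finset.sum_mul]

/-- A weighted convolution sum whose weight is small at small indices. -/
lemma sum_weight_conv_le {b e G : ℕ → ℝ} (hb : ∀ i, 0 ≤ b i) (he : ∀ i, 0 ≤ e i)
    {z Γ S R S' R' : ℝ} (hz : 0 ≤ z) (hΓ : 0 ≤ Γ) {J n : ℕ}
    (hGz : ∀ m ≤ 2 * J, G m ≤ z) (hG : ∀ m, G m ≤ z + Γ)
    (hS : ∑ j ∈ Finset.range n, b j ≤ S)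
    (hR : ∑ i ∈ Finset.range n, e i ≤ R)
    (hS' : ∑ j ∈ Finset.Ico J n, b j ≤ S')
    (hR' : ∑ i ∈ Finset.Ico J n, e i ≤ R') (hS0 : 0 ≤ S) :
    ∑ m ∈ Finset.range n, G m * (e m * S + ∑ j ∈ Finset.range m, b j * e (m - 1 - j)) ≤
      2 * (z * (R * S)) + Γ * (2 * (R' * S) + S' * R) := by
  set b' : ℕ → ℝ := fun j => if J ≤ j then b j else 0 with hb'
  set e' : ℕ → ℝ := fun j => if J ≤ j then e j else 0 with he'
  have hb'0 : ∀ i, 0 ≤ b' i := fun i => by simp only [hb']; split_ifs <;> simp [hb i]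
  have he'0 : ∀ i, 0 ≤ e' i := fun i => by simp only [he']; split_ifs <;> simp [he i]
  have hfil : ∀ f : ℕ → ℝ, ∑ j ∈ Finset.range n, (if J ≤ j then f j else 0) =
      ∑ j ∈ Finset.Ico J n, f j := fun f => by
    rw [← Finset.sum_filter]
    congr 1
    ext j
    simp only [Finset.mem_filter, Finset.mem_range, Finset.mem_Ico]
    omega
  have hbS : ∑ j ∈ Finset.range n, b' j ≤ S' := (hfil b).trans_le hS'
  have heR : ∑ j ∈ Finset.range n, e' j ≤ R' := (hfil e).trans_le hR'
  have hR'0 : 0 ≤ R' := (Finset.sum_nonneg fun i _ => he i).trans hR'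
  have h1 : ∀ m, G m * (e m * S) ≤ z * (e m * S) + Γ * (e' m * S) := fun m => by
    have hm := mul_nonneg (he m) hS0
    by_cases hJ : J ≤ m
    · simp only [he', hJ, if_true]
      rw [← add_mul]
      exact mul_le_mul_of_nonneg_right (hG m) hm
    · simp only [he', hJ, if_false]
      have := mul_le_mul_of_nonneg_right (hGz m (by omega)) hm
      linarith
  have h2 : ∀ m, ∀ j ∈ Finset.range m, G m * (b j * e (m - 1 - j)) ≤
      z * (b j * e (m - 1 - j)) + Γ * (b' j * e (m - 1 - j)) + Γ * (b j * e' (m - 1 - j)) := by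
    intro m j hj
    have hj' := Finset.mem_range.1 hj
    have hbe := mul_nonneg (hb j) (he (m - 1 - j))
    have hbe' := mul_nonneg hΓ (mul_nonneg (hb j) (he'0 (m - 1 - j)))
    have hb'e := mul_nonneg hΓ (mul_nonneg (hb'0 j) (he (m - 1 - j)))
    by_cases hm : m ≤ 2 * J
    · have := mul_le_mul_of_nonneg_right (hGz m hm) hbe
      linarith
    · have := mul_le_mul_of_nonneg_right (hG m) hbe
      rw [add_mul] at this
      by_cases hJ : J ≤ j
      · have : b' j = b j := by simp [hb', hJ]
        rw [this] at *
        linarith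
      · have : e' (m - 1 - j) = e (m - 1 - j) := by
          simp only [he']; rw [if_pos (by omega)]
        rw [this] at *
        linarith
  calc _ ≤ ∑ m ∈ Finset.range n, ((z * (e m * S) + Γ * (e' m * S)) +
        ∑ j ∈ Finset.range m, (z * (b j * e (m - 1 - j)) + Γ * (b' j * e (m - 1 - j)) +
          Γ * (b j * e' (m - 1 - j)))) := by
        refine Finset.sum_le_sum fun m _ => ?_
        rw [mul_add, Finset.mul_sum]
        exact add_le_add (h1 m) (Finset.sum_le_sum (h2 m))
    _ = z * ((∑ m ∈ Finset.range n, e m) * S) + Γ * ((∑ m ∈ Finset.range n, e' m) * S) +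
        (z * ∑ m ∈ Finset.range n, ∑ j ∈ Finset.range m, b j * e (m - 1 - j) +
          Γ * ∑ m ∈ Finset.range n, ∑ j ∈ Finset.range m, b' j * e (m - 1 - j) +
          Γ * ∑ m ∈ Finset.range n, ∑ j ∈ Finset.range m, b j * e' (m - 1 - j)) := by
        simp only [Finset.sum_add_distrib, Finset.mul_sum, Finset.sum_mul]
    _ ≤ z * (R * S) + Γ * (R' * S) + (z * (S * R) + Γ * (S' * R) + Γ * (S * R')) := by
        have hs := fun (x : ℕ → ℝ) (hx : ∀ i, 0 ≤ x i) =>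
          Finset.sum_nonneg (s := Finset.range n) fun i _ => hx i
        have k1 := (sum_range_conv_le hb he n).trans (mul_le_mul hS hR (hs e he) hS0)
        have k2 := (sum_range_conv_le hb'0 he n).trans
          (mul_le_mul hbS hR (hs e he) ((hs b' hb'0).trans hbS))
        have k3 := (sum_range_conv_le hb he'0 n).trans (mul_le_mul hS heR (hs e' he'0) hS0)
        gcongr
    _ = _ := by ring

/-- Comparison of a discretised Volterra operator with its averaged version, for which the
renewal coefficients produce exact cancellation. -/
lemma sum_renewal_error_le {w b e G γ : ℕ → ℝ} {p : ℕ → ℕ → ℝ} (hw : ∀ i, 0 < w i)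
    (hb : ∀ i, 0 ≤ b i)
    (hconv : ∀ m, ∑ j ∈ Finset.range (m + 1), b j * w (m - j) = w (m + 1) / w 0)
    (he0 : e 0 = w 0) {n : ℕ} (hp0 : 0 < n → p 0 0 ≤ w 0 * G 0)
    (hup : ∀ m < n, p 0 m ≤ w m * γ m + e m * G m)
    (hlow : ∀ m < n, ∀ j < m, w (m - 1 - j) * γ m - e (m - 1 - j) * G m ≤ p (j + 1) m) :
    ∑ m ∈ Finset.range n, (p 0 m * (1 / w 0) - ∑ j ∈ Finset.range m, b j * p (j + 1) m) ≤
      ∑ m ∈ Finset.range n,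
        G m * (e m * (1 / w 0) + ∑ j ∈ Finset.range m, b j * e (m - 1 - j)) := by
  have h0 := hw 0
  refine Finset.sum_le_sum fun m hm => ?_
  have hm := Finset.mem_range.1 hm
  rcases m with _ | m
  · simp only [Finset.range_zero, Finset.sum_empty, sub_zero, add_zero, he0]
    rw [mul_one_div_cancel h0.ne', mul_one_div, div_le_iff₀ h0]
    linarith [hp0 hm]
  · have h1 := mul_le_mul_of_nonneg_right (hup (m + 1) hm) (one_div_pos.2 h0).le
    have h2 : ∑ j ∈ Finset.range (m + 1), (b j * w (m - j) * γ (m + 1) -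
        G (m + 1) * (b j * e (m - j))) ≤ ∑ j ∈ Finset.range (m + 1), b j * p (j + 1) (m + 1) := by
      refine Finset.sum_le_sum fun j hj => ?_
      have := mul_le_mul_of_nonneg_left (hlow (m + 1) hm j (Finset.mem_range.1 hj)) (hb j)
      simp only [Nat.add_sub_cancel] at this
      linarith
    rw [Finset.sum_sub_distrib, ← Finset.sum_mul, hconv, ← Finset.mul_sum] at h2
    simp only [Nat.add_sub_cancel, mul_add]
    have h3 : w (m + 1) / w 0 * γ (m + 1) = w (m + 1) * γ (m + 1) * (1 / w 0) := by ring
    linarith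

/-- A nonincreasing, nonnegative, locally integrable kernel on `(0, ∞)` which is log-convex, the
latter being expressed through nonnegativity of quadratic forms. -/
structure IsLogConvexKernel (ω : ℝ → ℝ) : Prop where
  anti : AntitoneOn ω (Ioi 0)
  nonneg : ∀ x, 0 < x → 0 ≤ ω x
  int : ∀ T, 0 < T → IntervalIntegrable ω volume 0 T
  quad : ∀ x, 0 < x → ∀ h, 0 < h → ∀ y : ℝ,
    0 ≤ ω x + 2 * y * ω (x + h) + y ^ 2 * ω (x + 2 * h)

/-- The mass of `ω` on the `i`-th cell of length `ε`. -/
noncomputable def cellMass (ω : ℝ → ℝ) (ε : ℝ) (i : ℕ) : ℝ := ∫ θ in (0:ℝ)..ε, ω (i * ε + θ)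

namespace IsLogConvexKernel

variable {ω : ℝ → ℝ}

lemma int' (hk : IsLogConvexKernel ω) {a b : ℝ} (ha : 0 ≤ a) (hb : 0 ≤ b) :
    IntervalIntegrable ω volume a b := by
  have hT : 0 < max a b + 1 := by positivity
  refine (hk.int _ hT).mono_set ?_
  rw [uIcc_of_le hT.le]
  refine uIcc_subset_Icc ⟨ha, ?_⟩ ⟨hb, ?_⟩ <;> linarith [le_max_left a b, le_max_right a b]

lemma int_shift (hk : IsLogConvexKernel ω) {x ε : ℝ} (hx : 0 ≤ x) (hε : 0 ≤ ε) :
    IntervalIntegrable (fun θ => ω (x + θ)) volume 0 ε := by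
  simpa using (hk.int' hx (add_nonneg hx hε)).comp_add_left x

lemma int_shift_mul (hk : IsLogConvexKernel ω) {g : ℝ → ℝ} (hg : Continuous g) {x ε : ℝ}
    (hx : 0 ≤ x) (hε : 0 ≤ ε) (y : ℝ) :
    IntervalIntegrable (fun θ => ω (x + θ) * g (y + θ)) volume 0 ε :=
  (hk.int_shift hx hε).mul_continuousOn (by fun_prop)

lemma int_sub_mul (hk : IsLogConvexKernel ω) {g : ℝ → ℝ} (hg : Continuous g) {h a b : ℝ}
    (ha : h ≤ a) (hb : h ≤ b) :
    IntervalIntegrable (fun τ => ω (τ - h) * g τ) volume a b := by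
  have := (hk.int' (sub_nonneg.2 ha) (sub_nonneg.2 hb)).comp_sub_right h
  simp only [sub_add_cancel] at this
  exact this.mul_continuousOn hg.continuousOn

lemma cellMass_pos (hk : IsLogConvexKernel ω) (hpos : ∀ x, 0 < x → 0 < ω x) {ε : ℝ}
    (hε : 0 < ε) (i : ℕ) : 0 < cellMass ω ε i := by
  have hi : 0 ≤ (i : ℝ) * ε := by positivity
  exact intervalIntegral.intervalIntegral_pos_of_pos_on (hk.int_shift hi hε.le)
    (fun x hx => hpos _ (by linarith [hx.1])) hε

lemma cellMass_antitone (hk : IsLogConvexKernel ω) {ε : ℝ} (hε : 0 < ε) :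
    Antitone (cellMass ω ε) := by
  intro i j hij
  have hi : 0 ≤ (i : ℝ) * ε := by positivity
  have hj : (i : ℝ) * ε ≤ j * ε := by gcongr
  refine intervalIntegral.integral_mono_on_of_le_Ioo hε.le
    (hk.int_shift (hi.trans hj) hε.le) (hk.int_shift hi hε.le) fun x hx => ?_
  exact hk.anti (mem_Ioi.2 (by linarith [hx.1])) (mem_Ioi.2 (by linarith [hx.1])) (by linarith)

lemma cellMass_logConvex (hk : IsLogConvexKernel ω) {ε : ℝ} (hε : 0 < ε) (i : ℕ) :
    cellMass ω ε (i + 1) ^ 2 ≤ cellMass ω ε i * cellMass ω ε (i + 2) := by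
  have hi : 0 ≤ (i : ℝ) * ε := by positivity
  have h0 := hk.int_shift hi hε.le
  have h1 := hk.int_shift (x := ((i + 1 : ℕ) : ℝ) * ε) (by positivity) hε.le
  have h2 := hk.int_shift (x := ((i + 2 : ℕ) : ℝ) * ε) (by positivity) hε.le
  have key : ∀ y : ℝ, 0 ≤ cellMass ω ε (i + 2) * (y * y) + (2 * cellMass ω ε (i + 1)) * y +
      cellMass ω ε i := by
    intro y
    have : 0 ≤ ∫ θ in (0:ℝ)..ε, (ω (i * ε + θ) + 2 * y * ω (((i + 1 : ℕ) : ℝ) * ε + θ) +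
        y ^ 2 * ω (((i + 2 : ℕ) : ℝ) * ε + θ)) := by
      have := intervalIntegral.integral_mono_on_of_le_Ioo hε.le
        (IntervalIntegrable.refl.symm.trans (intervalIntegrable_const (c := (0:ℝ))))
        ((h0.add (h1.const_mul (2 * y))).add (h2.const_mul (y ^ 2))) fun x hx => by
          have := hk.quad (i * ε + x) (by linarith [hx.1]) ε hε y
          rwa [show i * ε + x + ε = ((i + 1 : ℕ) : ℝ) * ε + x by push_cast; ring,
            show i * ε + x + 2 * ε = ((i + 2 : ℕ) : ℝ) * ε + x by push_cast; ring] at this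
      simpa using this
    rw [intervalIntegral.integral_add (h0.add (h1.const_mul _)) (h2.const_mul _),
      intervalIntegral.integral_add h0 (h1.const_mul _), intervalIntegral.integral_const_mul,
      intervalIntegral.integral_const_mul] at this
    simp only [cellMass]
    linarith
  have := discrim_le_zero key
  rw [discrim] at this
  linarith

lemma sum_cellMass (hk : IsLogConvexKernel ω) {ε : ℝ} (hε : 0 < ε) (n : ℕ) :
    ∑ i ∈ Finset.range n, cellMass ω ε i = ∫ τ in (0:ℝ)..n * ε, ω τ := by
  have := intervalIntegral.sum_integral_adjacent_intervals_Ico (f := ω) (μ := volume)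
    (a := fun i : ℕ => (i : ℝ) * ε) (Nat.zero_le n)
    fun k _ => hk.int' (by positivity) (by positivity)
  simp only [Nat.cast_zero, zero_mul] at this
  rw [← this, Finset.range_eq_Ico]
  refine Finset.sum_congr rfl fun i _ => ?_
  rw [cellMass, intervalIntegral.integral_comp_add_left]
  congr 1 <;> (push_cast; ring)

end IsLogConvexKernel

lemma integral_mul_cell_bounds {φ γ : ℝ → ℝ} {ε lo hi G : ℝ} (hε : 0 < ε)
    (hφ : IntervalIntegrable φ volume 0 ε) (hγ : Continuous γ)
    (hlo : ∀ x ∈ Ioo 0 ε, lo ≤ φ x) (hhi : ∀ x ∈ Ioo 0 ε, φ x ≤ hi)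
    (hγ0 : ∀ x, 0 ≤ γ x) (hγG : ∀ x ∈ Icc 0 ε, γ x ≤ G) :
    (∫ x in (0:ℝ)..ε, φ x * γ x) ≤ (∫ x in (0:ℝ)..ε, φ x) * ((∫ x in (0:ℝ)..ε, γ x) / ε) +
        ε * (hi - lo) * G ∧
      (∫ x in (0:ℝ)..ε, φ x) * ((∫ x in (0:ℝ)..ε, γ x) / ε) - ε * (hi - lo) * G ≤
        ∫ x in (0:ℝ)..ε, φ x * γ x := by
  have hφγ : IntervalIntegrable (fun x => φ x * γ x) volume 0 ε :=
    hφ.mul_continuousOn hγ.continuousOn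
  have hγi : IntervalIntegrable γ volume 0 ε := hγ.intervalIntegrable _ _
  have h1 := intervalIntegral.integral_mono_on_of_le_Ioo hε.le hφγ (hγi.const_mul hi)
    fun x hx => mul_le_mul_of_nonneg_right (hhi x hx) (hγ0 x)
  have h2 := intervalIntegral.integral_mono_on_of_le_Ioo hε.le (hγi.const_mul lo) hφγ
    fun x hx => mul_le_mul_of_nonneg_right (hlo x hx) (hγ0 x)
  have h3 := intervalIntegral.integral_mono_on_of_le_Ioo hε.le hφ
    (intervalIntegrable_const (c := hi)) hhi
  have h4 := intervalIntegral.integral_mono_on_of_le_Ioo hε.le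
    (intervalIntegrable_const (c := lo)) hφ hlo
  have h5 := intervalIntegral.integral_mono_on hε.le hγi
    (intervalIntegrable_const (c := G)) hγG
  have h6 := intervalIntegral.integral_nonneg (μ := volume) hε.le fun x _ => hγ0 x
  simp only [intervalIntegral.integral_const_mul, intervalIntegral.integral_const, sub_zero,
    smul_eq_mul] at h1 h2 h3 h4 h5
  set P := ∫ x in (0:ℝ)..ε, φ x
  set Q := ∫ x in (0:ℝ)..ε, γ x
  have hQ : 0 ≤ Q / ε := by positivity
  have h7 := mul_le_mul_of_nonneg_right h3 hQ
  have h8 := mul_le_mul_of_nonneg_right h4 hQ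
  have h9 : ∀ c, ε * c * (Q / ε) = c * Q := fun c => by field_simp
  rw [h9] at h7 h8
  have h10 : 0 ≤ hi - lo := by
    have := (hlo (ε / 2) ⟨by linarith, by linarith⟩).trans
      (hhi (ε / 2) ⟨by linarith, by linarith⟩)
    linarith
  have h11 := mul_le_mul_of_nonneg_left h5 h10
  constructor <;> linarith

/-- Bound for the deviation of `ω` from its average on the `i`-th cell of length `ε`. -/
noncomputable def cellOsc (ω : ℝ → ℝ) (ε : ℝ) : ℕ → ℝ
  | 0 => cellMass ω ε 0
  | i + 1 => ε * (ω ((i + 1 : ℕ) * ε) - ω ((i + 2 : ℕ) * ε))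

namespace IsLogConvexKernel

variable {ω : ℝ → ℝ}

lemma cellOsc_nonneg (hk : IsLogConvexKernel ω) {ε : ℝ} (hε : 0 < ε) (i : ℕ) :
    0 ≤ cellOsc ω ε i := by
  rcases i with _ | i
  · refine intervalIntegral.integral_nonneg_of_ae_restrict hε.le ?_
    rw [← Measure.restrict_congr_set Ioc_ae_eq_Icc]
    filter_upwards [ae_restrict_mem measurableSet_Ioc] with x hx
    exact hk.nonneg _ (by simpa using hx.1)
  · refine mul_nonneg hε.le (sub_nonneg.2 (hk.anti ?_ ?_ ?_))
    · exact mem_Ioi.2 (by positivity)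
    · exact mem_Ioi.2 (by positivity)
    · gcongr; simp

lemma sum_Ico_cellOsc (hk : IsLogConvexKernel ω) {ε : ℝ} (hε : 0 < ε) {J : ℕ} (hJ : 0 < J)
    (n : ℕ) : ∑ i ∈ Finset.Ico J n, cellOsc ω ε i ≤ ε * ω (J * ε) := by
  have hω : ∀ k : ℕ, 0 < k → 0 ≤ ω (k * ε) := fun k hk' => hk.nonneg _ (by positivity)
  rcases le_or_gt n J with hn | hn
  · rw [Finset.Ico_eq_empty_of_le hn]; exact mul_nonneg hε.le (hω J hJ)
  suffices h : ∑ i ∈ Finset.Ico J n, cellOsc ω ε i = ε * (ω (J * ε) - ω (n * ε)) by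
    rw [h]; exact mul_le_mul_of_nonneg_left (by linarith [hω n (by omega)]) hε.le
  induction n, hn.le using Nat.le_induction with
  | base => simp
  | succ n hn' ih =>
    rw [Finset.sum_Ico_succ_top hn']
    obtain ⟨k, rfl⟩ : ∃ k, n = k + 1 := ⟨n - 1, by omega⟩
    rcases hn'.eq_or_lt with h | h
    · rw [h]; simp [cellOsc, add_assoc, one_add_one_eq_two]
    · rw [ih h, cellOsc]; ring_nf

lemma sum_range_cellOsc (hk : IsLogConvexKernel ω) {ε : ℝ} (hε : 0 < ε) (n : ℕ) :
    ∑ i ∈ Finset.range n, cellOsc ω ε i ≤ 2 * cellMass ω ε 0 := by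
  have h0 : 0 ≤ cellMass ω ε 0 := hk.cellOsc_nonneg hε 0
  rcases n with _ | n
  · simpa using h0
  rw [Finset.range_eq_Ico, Finset.sum_eq_sum_Ico_succ_bot (Nat.succ_pos n)]
  have h1 := hk.sum_Ico_cellOsc hε one_pos (n + 1)
  have h2 : ε * ω ((1 : ℕ) * ε) ≤ cellMass ω ε 0 := by
    have := intervalIntegral.integral_mono_on_of_le_Ioo hε.le
      (intervalIntegrable_const (c := ω ε)) (hk.int_shift (x := ((0 : ℕ) : ℝ) * ε) (by simp) hε.le)
      fun x hx => hk.anti (mem_Ioi.2 (by simpa using hx.1)) (mem_Ioi.2 hε) (by simpa using hx.2.le)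
    simpa [cellMass] using this
  have h3 : cellOsc ω ε 0 = cellMass ω ε 0 := rfl
  simp only [zero_add] at h1 ⊢
  linarith

lemma cell_bounds (hk : IsLogConvexKernel ω) {g : ℝ → ℝ} (hg : Continuous g)
    (hg0 : ∀ x, 0 ≤ g x) {ε y G : ℝ} (hε : 0 < ε) (hG : ∀ θ ∈ Icc 0 ε, g (y + θ) ≤ G) (i : ℕ) :
    (∫ θ in (0:ℝ)..ε, ω (i * ε + θ) * g (y + θ)) ≤
        cellMass ω ε i * ((∫ θ in (0:ℝ)..ε, g (y + θ)) / ε) + cellOsc ω ε i * G ∧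
      cellMass ω ε i * ((∫ θ in (0:ℝ)..ε, g (y + θ)) / ε) - cellOsc ω ε i * G ≤
        ∫ θ in (0:ℝ)..ε, ω (i * ε + θ) * g (y + θ) := by
  rcases i with _ | i
  · have hω0 : ∀ θ ∈ Ioo 0 ε, 0 ≤ ω ((0 : ℕ) * ε + θ) := fun θ hθ =>
      hk.nonneg _ (by simpa using hθ.1)
    have hωi := hk.int_shift (x := ((0 : ℕ) : ℝ) * ε) (by simp) hε.le
    have hintg := hk.int_shift_mul hg (x := ((0 : ℕ) : ℝ) * ε) (by simp) hε.le y
    have hz : IntervalIntegrable (fun _ : ℝ => (0:ℝ)) volume 0 ε := intervalIntegrable_const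
    have h1 := intervalIntegral.integral_mono_on_of_le_Ioo hε.le hintg (hωi.mul_const G)
      fun θ hθ => mul_le_mul_of_nonneg_left (hG θ (Ioo_subset_Icc_self hθ)) (hω0 θ hθ)
    have h2 := intervalIntegral.integral_mono_on_of_le_Ioo hε.le hz hintg
      fun θ hθ => mul_nonneg (hω0 θ hθ) (hg0 _)
    have hgi : IntervalIntegrable (fun θ => g (y + θ)) volume 0 ε :=
      (by fun_prop : Continuous fun θ => g (y + θ)).intervalIntegrable _ _
    have h3 := intervalIntegral.integral_mono_on hε.le hgi
      (intervalIntegrable_const (c := G)) hG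
    have h4 := intervalIntegral.integral_nonneg (μ := volume) hε.le fun θ _ => hg0 (y + θ)
    have h5 : 0 ≤ cellMass ω ε 0 := hk.cellOsc_nonneg hε 0
    simp only [intervalIntegral.integral_mul_const, intervalIntegral.integral_const, sub_zero,
      smul_eq_mul, mul_zero] at h1 h2 h3
    have h6 : (∫ θ in (0:ℝ)..ε, g (y + θ)) / ε ≤ G := by rwa [div_le_iff₀' hε]
    have h7 := mul_le_mul_of_nonneg_left h6 h5
    have h8 : 0 ≤ cellMass ω ε 0 * ((∫ θ in (0:ℝ)..ε, g (y + θ)) / ε) := by positivity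
    change _ ≤ cellMass ω ε 0 * G at h1
    simp only [cellOsc]
    exact ⟨h1.trans (by linarith), le_trans (by linarith) h2⟩
  · refine integral_mul_cell_bounds hε (hk.int_shift (by positivity) hε.le) (by fun_prop)
      (fun x hx => ?_) (fun x hx => ?_) (fun x => hg0 _) hG
    · refine hk.anti (mem_Ioi.2 ?_) (mem_Ioi.2 (by positivity)) ?_
      · have := hx.1; positivity
      · have := hx.2; push_cast; linarith
    · refine hk.anti (mem_Ioi.2 (by positivity)) (mem_Ioi.2 ?_) ?_
      · have := hx.1; positivity
      · linarith [hx.1]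

lemma integral_sub_mul_eq_sum (hk : IsLogConvexKernel ω) {g : ℝ → ℝ} (hg : Continuous g)
    {ε : ℝ} (hε : 0 < ε) {j n : ℕ} (hjn : j ≤ n) :
    ∫ τ in (j * ε)..(n * ε), ω (τ - j * ε) * g τ =
      ∑ m ∈ Finset.Ico j n, ∫ θ in (0:ℝ)..ε, ω ((m - j : ℕ) * ε + θ) * g (m * ε + θ) := by
  rw [← intervalIntegral.sum_integral_adjacent_intervals_Ico (a := fun i : ℕ => (i : ℝ) * ε) hjn]
  · refine Finset.sum_congr rfl fun m hm => ?_
    have hm := (Finset.mem_Ico.1 hm).1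
    have := intervalIntegral.integral_comp_add_left (a := 0) (b := ε)
      (fun τ => ω (τ - j * ε) * g τ) (m * ε)
    rw [add_zero, show (m : ℝ) * ε + ε = (m + 1 : ℕ) * ε by push_cast; ring] at this
    rw [← this]
    refine intervalIntegral.integral_congr fun θ _ => ?_
    rw [Nat.cast_sub hm]
    ring_nf
  · intro k hk'
    refine hk.int_sub_mul hg ?_ ?_ <;> gcongr
    · exact hk'.1
    · exact hk'.1.trans (Nat.le_succ k)

lemma sum_renewalCoeff_mul_sub_le (hk : IsLogConvexKernel ω) (hpos : ∀ x, 0 < x → 0 < ω x)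
    {g : ℝ → ℝ} (hg : Continuous g) (hg0 : ∀ x, 0 ≤ g x) {ε : ℝ} (hε : 0 < ε) {n : ℕ}
    {G : ℕ → ℝ} (hG : ∀ m < n, ∀ θ ∈ Icc 0 ε, g (m * ε + θ) ≤ G m) :
    ∑ j ∈ Finset.range n, renewalCoeff (cellMass ω ε) j *
      ((∫ τ in (0:ℝ)..n * ε, ω τ * g τ) -
        ∫ τ in ((j + 1 : ℕ) * ε)..(n * ε), ω (τ - (j + 1 : ℕ) * ε) * g τ) ≤
    ∑ m ∈ Finset.range n, G m * (cellOsc ω ε m * (1 / cellMass ω ε 0) +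
      ∑ j ∈ Finset.range m, renewalCoeff (cellMass ω ε) j * cellOsc ω ε (m - 1 - j)) := by
  have hw := hk.cellMass_pos hpos hε
  have hb := renewalCoeff_nonneg hw (hk.cellMass_logConvex hε)
  set w := cellMass ω ε with hwdef
  set b := renewalCoeff w
  set p : ℕ → ℕ → ℝ := fun j m =>
    ∫ θ in (0:ℝ)..ε, ω ((m - j : ℕ) * ε + θ) * g (m * ε + θ) with hp
  have hΦ0 : ∫ τ in (0:ℝ)..n * ε, ω τ * g τ = ∑ m ∈ Finset.range n, p 0 m := by
    have := hk.integral_sub_mul_eq_sum hg hε (Nat.zero_le n)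
    simp only [Nat.cast_zero, zero_mul, sub_zero] at this
    rw [this, Finset.range_eq_Ico]
  have hΦ : ∀ j ∈ Finset.range n,
      ∫ τ in ((j + 1 : ℕ) * ε)..(n * ε), ω (τ - (j + 1 : ℕ) * ε) * g τ =
        ∑ m ∈ Finset.Ico (j + 1) n, p (j + 1) m := fun j hj =>
    hk.integral_sub_mul_eq_sum hg hε (Finset.mem_range.1 hj)
  have hΦ0' : 0 ≤ ∑ m ∈ Finset.range n, p 0 m := by
    refine Finset.sum_nonneg fun m _ => ?_
    have hz : IntervalIntegrable (fun _ : ℝ => (0:ℝ)) volume 0 ε := intervalIntegrable_const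
    have := intervalIntegral.integral_mono_on_of_le_Ioo hε.le hz
      (hk.int_shift_mul hg (x := ((m - 0 : ℕ) : ℝ) * ε) (by positivity) hε.le (m * ε))
      fun θ hθ => mul_nonneg (hk.nonneg _ (by have := hθ.1; positivity)) (hg0 _)
    simpa [hp] using this
  calc _ = ∑ j ∈ Finset.range n, (b j * (∑ m ∈ Finset.range n, p 0 m) -
        ∑ m ∈ Finset.Ico (j + 1) n, b j * p (j + 1) m) := by
        refine Finset.sum_congr rfl fun j hj => ?_
        rw [hΦ0, hΦ j hj, mul_sub, Finset.mul_sum (Finset.Ico _ _)]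
    _ ≤ (∑ m ∈ Finset.range n, p 0 m) * (1 / w 0) -
        ∑ j ∈ Finset.range n, ∑ m ∈ Finset.Ico (j + 1) n, b j * p (j + 1) m := by
        rw [Finset.sum_sub_distrib, ← Finset.sum_mul, mul_comm]
        gcongr
        exact sum_renewalCoeff_le hw (hk.cellMass_antitone hε) (hk.cellMass_logConvex hε) n
    _ = ∑ m ∈ Finset.range n, (p 0 m * (1 / w 0) -
        ∑ j ∈ Finset.range m, b j * p (j + 1) m) := by
        rw [Finset.sum_sub_distrib, ← Finset.sum_mul]
        congr 1
        exact Finset.sum_comm' fun x y => by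
          simp only [Finset.mem_range, Finset.mem_Ico]; omega
    _ ≤ _ := by
        refine sum_renewal_error_le (e := cellOsc ω ε) (γ := fun m => (∫ θ in (0:ℝ)..ε, g (m * ε + θ)) / ε) hw hb
          (renewalCoeff_conv hw) rfl (fun hn => ?_) (fun m hm => ?_) (fun m hm j hj => ?_)
        · have hωi := hk.int_shift (x := ((0 : ℕ) : ℝ) * ε) (by simp) hε.le
          have h1 := intervalIntegral.integral_mono_on_of_le_Ioo hε.le
            (hk.int_shift_mul hg (x := ((0 : ℕ) : ℝ) * ε) (by simp) hε.le ((0 : ℕ) * ε))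
            (hωi.mul_const (G 0)) fun θ hθ =>
              mul_le_mul_of_nonneg_left (hG 0 hn θ (Ioo_subset_Icc_self hθ))
                (hk.nonneg _ (by simpa using hθ.1))
          rwa [intervalIntegral.integral_mul_const] at h1
        · exact (hk.cell_bounds hg hg0 hε (hG m hm) m).1
        · have := (hk.cell_bounds hg hg0 hε (hG m hm) (m - 1 - j)).2
          simp only [hp]
          rwa [show m - (j + 1) = m - 1 - j by omega]

open Filter Topology

lemma integral_sub_integral_le (hk : IsLogConvexKernel ω) {g : ℝ → ℝ} (hg : Continuous g)
    (hg0 : ∀ x, 0 ≤ g x) {h T t : ℝ} (hh : 0 ≤ h) (hhT : h ≤ T) (hTt : T ≤ t) :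
    (∫ τ in (0:ℝ)..t, ω τ * g τ) - ∫ τ in h..t, ω (τ - h) * g τ ≤
      (∫ τ in (0:ℝ)..T, ω τ * g τ) - ∫ τ in h..T, ω (τ - h) * g τ := by
  have hi : ∀ a b, 0 ≤ a → 0 ≤ b → IntervalIntegrable (fun τ => ω τ * g τ) volume a b :=
    fun a b ha hb => (hk.int' ha hb).mul_continuousOn hg.continuousOn
  have hT : 0 ≤ T := hh.trans hhT
  rw [← intervalIntegral.integral_add_adjacent_intervals (hi 0 T le_rfl hT)
      (hi T t hT (hT.trans hTt)),
    ← intervalIntegral.integral_add_adjacent_intervals (hk.int_sub_mul hg le_rfl hhT)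
      (hk.int_sub_mul hg hhT (hhT.trans hTt))]
  have := intervalIntegral.integral_mono_on_of_le_Ioo hTt (hi T t hT (hT.trans hTt))
    (hk.int_sub_mul hg hhT (hhT.trans hTt)) fun x hx => by
      refine mul_le_mul_of_nonneg_right (hk.anti ?_ ?_ ?_) (hg0 x)
      · exact mem_Ioi.2 (by linarith [hx.1])
      · exact mem_Ioi.2 (by linarith [hx.1])
      · linarith
  linarith

lemma tendsto_integral_zero (hk : IsLogConvexKernel ω) :
    Tendsto (fun x => ∫ τ in (0:ℝ)..x, ω τ) (𝓝[>] 0) (𝓝 0) := by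
  have h1 : IntegrableOn ω (uIcc 0 1) volume := by
    rw [uIcc_of_le zero_le_one]
    exact (intervalIntegrable_iff_integrableOn_Icc_of_le zero_le_one).1 (hk.int 1 one_pos)
  have h2 := intervalIntegral.continuousOn_primitive_interval h1 0 (by simp)
  rw [uIcc_of_le zero_le_one, ContinuousWithinAt, intervalIntegral.integral_same] at h2
  exact h2.mono_left (nhdsWithin_le_of_mem (Icc_mem_nhdsGT one_pos))

lemma mul_le_integral (hk : IsLogConvexKernel ω) {x : ℝ} (hx : 0 < x) :
    x * ω x ≤ ∫ τ in (0:ℝ)..x, ω τ := by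
  have := intervalIntegral.integral_mono_on_of_le_Ioo hx.le
    (intervalIntegrable_const (c := ω x)) (hk.int x hx)
    fun y hy => hk.anti (mem_Ioi.2 hy.1) (mem_Ioi.2 hx) hy.2.le
  simpa using this

lemma tendsto_div_integral_zero (hk : IsLogConvexKernel ω)
    (hunb : ∀ C, ∃ x, 0 < x ∧ C < ω x) :
    Tendsto (fun x => x / ∫ τ in (0:ℝ)..x, ω τ) (𝓝[>] 0) (𝓝 0) := by
  rw [Metric.tendsto_nhds]
  intro r hr
  obtain ⟨x₀, hx₀, hC⟩ := hunb (1 / r)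
  filter_upwards [Ioc_mem_nhdsGT hx₀] with x hx
  have h1 := hk.anti (mem_Ioi.2 hx.1) (mem_Ioi.2 hx₀) hx.2
  have h2 : x * (1 / r) < ∫ τ in (0:ℝ)..x, ω τ :=
    (mul_lt_mul_of_pos_left (hC.trans_le h1) hx.1).trans_le (hk.mul_le_integral hx.1)
  have h3 : 0 < ∫ τ in (0:ℝ)..x, ω τ := lt_trans (mul_pos hx.1 (by positivity)) h2
  rw [Real.dist_eq, sub_zero, abs_of_pos (div_pos hx.1 h3), div_lt_iff₀ h3]
  rwa [mul_one_div, div_lt_iff₀' hr] at h2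

/-- The discretised estimate with mesh `ε`, `J * ε` being the scale below which `g ≤ z`. -/
lemma discrete_estimate (hk : IsLogConvexKernel ω) (hpos : ∀ x, 0 < x → 0 < ω x)
    {g : ℝ → ℝ} (hg : Continuous g) (hg0 : ∀ x, 0 ≤ g x) {ε c z Γ : ℝ} (hε : 0 < ε)
    (hc0 : 0 ≤ c) (hz : 0 ≤ z) (hΓ : 0 ≤ Γ) {J m n : ℕ} (hJ : 0 < J) (hm : 0 < m) (hmn : m ≤ n)
    (hgz : ∀ x ∈ Icc 0 ((3 * J : ℕ) * ε), g x ≤ z) (hgΓ : ∀ x ∈ Icc 0 (n * ε), g x ≤ Γ)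
    (hc : ∀ h ∈ Ioc 0 (n * ε), c * h ≤
      (∫ τ in (0:ℝ)..n * ε, ω τ * g τ) - ∫ τ in h..n * ε, ω (τ - h) * g τ) :
    c * (m * ε) * (1 / (∫ τ in (0:ℝ)..m * ε, ω τ) - 1 / ∫ τ in (0:ℝ)..n * ε, ω τ) ≤
      4 * z + Γ * (2 * ω (J * ε) * (ε / ∫ τ in (0:ℝ)..ε, ω τ) +
        2 / (∫ τ in (0:ℝ)..J * ε, ω τ) * ∫ τ in (0:ℝ)..ε, ω τ) := by
  have hw := hk.cellMass_pos hpos hε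
  have hanti := hk.cellMass_antitone hε
  have hlc := hk.cellMass_logConvex hε
  have hb := renewalCoeff_nonneg hw hlc
  have hw0 : cellMass ω ε 0 = ∫ τ in (0:ℝ)..ε, ω τ := by simp [cellMass]
  rw [← hw0, ← hk.sum_cellMass hε, ← hk.sum_cellMass hε, ← hk.sum_cellMass hε]
  have hpow := hw 0
  set w := cellMass ω ε with hwdef
  set b := renewalCoeff w with hbdef
  set G : ℕ → ℝ := fun k => if k ≤ 2 * J then z else z + Γ with hGdef
  have hG : ∀ k < n, ∀ θ ∈ Icc 0 ε, g (k * ε + θ) ≤ G k := by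
    intro k hk' θ hθ
    simp only [hGdef]
    have h0 : 0 ≤ (k : ℝ) * ε + θ := by have := hθ.1; positivity
    split_ifs with hkJ
    · refine hgz _ ⟨h0, ?_⟩
      have : ((k : ℝ) + 1) * ε ≤ (3 * J : ℕ) * ε := by
        gcongr; exact_mod_cast (by omega : k + 1 ≤ 3 * J)
      linarith [hθ.2]
    · have : ((k : ℝ) + 1) * ε ≤ n * ε := by
        gcongr; exact_mod_cast hk'
      linarith [hgΓ _ ⟨h0, by linarith [hθ.2]⟩]
  have hup := hk.sum_renewalCoeff_mul_sub_le hpos hg hg0 hε hG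
  have hW : 0 < ∑ l ∈ Finset.range J, w l :=
    Finset.sum_pos (fun i _ => hw i) (Finset.nonempty_range_iff.2 hJ.ne')
  have hS' : ∑ j ∈ Finset.Ico J n, b j ≤ 1 / ∑ l ∈ Finset.range J, w l := by
    refine le_trans ?_ ((le_div_iff₀ hW).2 (renewalTail_mul_sum_le hw hlc hanti J))
    rcases le_total J n with h | h
    · have h1 := renewalTail_nonneg hw hanti hlc n
      rw [Finset.sum_Ico_eq_sub _ h]
      simp only [renewalTail] at h1 ⊢
      linarith
    · rw [Finset.Ico_eq_empty_of_le h]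
      exact renewalTail_nonneg hw hanti hlc J
  have hbound := sum_weight_conv_le (G := G) hb (hk.cellOsc_nonneg hε) hz hΓ (J := J) (n := n)
    (fun k hk' => by simp [hGdef, hk']) (fun k => by
      simp only [hGdef]; split_ifs <;> linarith)
    (sum_renewalCoeff_le hw hanti hlc n) (hk.sum_range_cellOsc hε n) hS'
    (hk.sum_Ico_cellOsc hε hJ n) (by positivity)
  have hlow : c * ε * ∑ j ∈ Finset.range n, ((j : ℝ) + 1) * b j ≤
      ∑ j ∈ Finset.range n, b j * ((∫ τ in (0:ℝ)..n * ε, ω τ * g τ) -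
        ∫ τ in ((j + 1 : ℕ) * ε)..(n * ε), ω (τ - (j + 1 : ℕ) * ε) * g τ) := by
    rw [Finset.mul_sum]
    refine Finset.sum_le_sum fun j hj => ?_
    have hj := Finset.mem_range.1 hj
    have := mul_le_mul_of_nonneg_left (hc ((j + 1 : ℕ) * ε) ⟨by positivity, by gcongr; exact hj⟩)
      (hb j)
    refine le_trans (le_of_eq ?_) this
    push_cast; ring
  have hk1 := mul_le_mul_of_nonneg_left (le_sum_succ_mul_renewalCoeff hw hanti hlc hm hmn)
    (mul_nonneg hc0 hε.le)
  calc _ = c * ε * (m * (1 / (∑ l ∈ Finset.range m, w l) - 1 / ∑ l ∈ Finset.range n, w l)) := by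
        ring
    _ ≤ _ := hk1.trans (hlow.trans (hup.trans hbound))
    _ = _ := by
        rw [← hwdef]
        field_simp
        ring

lemma not_linear_decrease_of_unbounded (hk : IsLogConvexKernel ω)
    (hpos : ∀ x, 0 < x → 0 < ω x) (hunb : ∀ C, ∃ x, 0 < x ∧ C < ω x)
    {g : ℝ → ℝ} (hg : Continuous g) (hg0 : ∀ x, 0 ≤ g x) (hgz : g 0 = 0) {T c : ℝ}
    (hT : 0 < T) (hc0 : 0 < c)
    (hc : ∀ h ∈ Ioc 0 T, c * h ≤
      (∫ τ in (0:ℝ)..T, ω τ * g τ) - ∫ τ in h..T, ω (τ - h) * g τ) : False := by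
  set Ω : ℝ → ℝ := fun x => ∫ τ in (0:ℝ)..x, ω τ with hΩ
  have hpos' : ∀ a b, 0 ≤ a → a < b → 0 < ∫ τ in a..b, ω τ := fun a b ha hab =>
    intervalIntegral.intervalIntegral_pos_of_pos_on (hk.int' ha (ha.trans hab.le))
      (fun x hx => hpos x (ha.trans_lt hx.1)) hab
  have hlt : Ω (T / 2) < Ω T := by
    have := intervalIntegral.integral_add_adjacent_intervals (hk.int' le_rfl (half_pos hT).le)
      (hk.int' (half_pos hT).le hT.le)
    have := hpos' (T / 2) T (half_pos hT).le (half_lt_self hT)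
    simp only [hΩ]; linarith
  set q : ℝ := c * (T / 2) * (1 / Ω (T / 2) - 1 / Ω T) with hq
  have hq0 : 0 < q := by
    have := one_div_lt_one_div_of_lt (hpos' 0 (T / 2) le_rfl (half_pos hT)) hlt
    have : 0 < 1 / Ω (T / 2) - 1 / Ω T := sub_pos.2 this
    positivity
  obtain ⟨ρ, hρ, hgρ⟩ := Metric.continuousAt_iff.1 (hg.continuousAt (x := 0)) (q / 8) (by positivity)
  obtain ⟨L, hL⟩ := exists_nat_gt (max 1 (2 * T / ρ))
  have hL0 : (0:ℝ) < L := lt_of_lt_of_le one_pos ((le_max_left _ _).trans hL.le)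
  have hL0' : 0 < L := by exact_mod_cast hL0
  have hLρ : 2 * T < L * ρ := by
    rw [← div_lt_iff₀ hρ]; exact (le_max_right _ _).trans_lt hL
  set η : ℝ := T / (2 * L) with hη
  have hη0 : 0 < η := by positivity
  have hηρ : 3 * η < ρ := by
    rw [hη, ← mul_div_assoc, div_lt_iff₀ (by positivity)]; nlinarith
  obtain ⟨Γ, hΓ⟩ := isCompact_Icc.bddAbove_image (hg.continuousOn (s := Icc 0 T))
  have hΓ' : ∀ x ∈ Icc 0 T, g x ≤ Γ := fun x hx => hΓ (mem_image_of_mem g hx)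
  have hΓ0 : 0 ≤ Γ := (hg0 0).trans (hΓ' 0 ⟨le_rfl, hT.le⟩)
  have hmain : ∀ k : ℕ, q ≤ 4 * (q / 8) + Γ * (2 * ω η * (η / (k + 1 : ℕ) / Ω (η / (k + 1 : ℕ))) +
      2 / Ω η * Ω (η / (k + 1 : ℕ))) := by
    intro k
    have hk0 : (0:ℝ) < (k + 1 : ℕ) := by positivity
    have e1 : ((k + 1 : ℕ) : ℝ) * (η / (k + 1 : ℕ)) = η := by field_simp
    have e2 : ((L * (k + 1) : ℕ) : ℝ) * (η / (k + 1 : ℕ)) = T / 2 := by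
      rw [Nat.cast_mul, mul_assoc, e1, hη]; field_simp
    have e3 : ((2 * (L * (k + 1)) : ℕ) : ℝ) * (η / (k + 1 : ℕ)) = T := by
      rw [Nat.cast_mul, mul_assoc, e2]; push_cast; ring
    have e4 : ((3 * (k + 1) : ℕ) : ℝ) * (η / (k + 1 : ℕ)) = 3 * η := by
      rw [Nat.cast_mul, mul_assoc, e1]; push_cast; ring
    have := hk.discrete_estimate hpos hg hg0 (ε := η / (k + 1 : ℕ)) (by positivity) hc0.le
      (z := q / 8) (by positivity) hΓ0 (J := k + 1) (m := L * (k + 1)) (n := 2 * (L * (k + 1)))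
      (Nat.succ_pos k) (by positivity) (by omega)
      (by
        rw [e4]; intro x hx
        have := hgρ (x := x) (by
          rw [Real.dist_eq, sub_zero, abs_of_nonneg hx.1]; exact hx.2.trans_lt hηρ)
        rw [hgz, Real.dist_eq, sub_zero, abs_of_nonneg (hg0 x)] at this
        exact this.le)
      (by rwa [e3]) (by rwa [e3])
    rwa [e1, e2, e3] at this
  have hε : Tendsto (fun k : ℕ => η / (k + 1 : ℕ)) atTop (𝓝[>] 0) := by
    refine tendsto_nhdsWithin_iff.2 ⟨?_, .of_forall fun k => mem_Ioi.2 (by positivity)⟩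
    exact (tendsto_const_div_atTop_nhds_zero_nat η).comp (tendsto_add_atTop_nat 1)
  have h1 := (hk.tendsto_div_integral_zero hunb).comp hε
  have h2 := hk.tendsto_integral_zero.comp hε
  have h3 := (((h1.const_mul (2 * ω η)).add (h2.const_mul (2 / Ω η))).const_mul Γ).const_add
    (4 * (q / 8))
  have := ge_of_tendsto' h3 hmain
  linarith

lemma not_linear_decrease_of_bounded (hk : IsLogConvexKernel ω) {C : ℝ}
    (hC : ∀ x, 0 < x → ω x ≤ C)
    {g : ℝ → ℝ} (hg : Continuous g) (hg0 : ∀ x, 0 ≤ g x) (hgz : g 0 = 0) {T c : ℝ}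
    (hT : 0 < T) (hc0 : 0 < c)
    (hc : ∀ h ∈ Ioc 0 T, c * h ≤
      (∫ τ in (0:ℝ)..T, ω τ * g τ) - ∫ τ in h..T, ω (τ - h) * g τ) : False := by
  have hC0 : 0 ≤ C := (hk.nonneg 1 one_pos).trans (hC 1 one_pos)
  set z := c / (2 * (C + 1)) with hz
  have hz0 : 0 < z := by positivity
  obtain ⟨ρ, hρ, hgρ⟩ := Metric.continuousAt_iff.1 (hg.continuousAt (x := 0)) z hz0
  set h := min T (ρ / 2) with hh
  have hh0 : 0 < h := by positivity
  have h1 := (hc h ⟨hh0, min_le_left _ _⟩).trans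
    (hk.integral_sub_integral_le hg hg0 hh0.le le_rfl (min_le_left _ _))
  rw [intervalIntegral.integral_same, sub_zero] at h1
  have h2 := intervalIntegral.integral_mono_on_of_le_Ioo hh0.le
    ((hk.int h hh0).mul_continuousOn hg.continuousOn)
    (intervalIntegrable_const (c := (C + 1) * z)) fun x hx => by
      have h3 := hgρ (x := x) (by
        rw [Real.dist_eq, sub_zero, abs_of_pos hx.1]
        linarith [hx.2, min_le_right T (ρ / 2)])
      rw [hgz, Real.dist_eq, sub_zero, abs_of_nonneg (hg0 x)] at h3
      exact mul_le_mul ((hC x hx.1).trans (by linarith)) h3.le (hg0 x) (by linarith)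
  have h4 : (C + 1) * z = c / 2 := by rw [hz]; field_simp
  rw [intervalIntegral.integral_const, h4, smul_eq_mul, sub_zero] at h2
  nlinarith

/-- A convolution `∫₀^r ω(r - s) G(s) ds` with `G ≥ 0` continuous, `G t = 0`, written in the
backward variable `τ = t - s`, cannot increase linearly as `r` tends to `t` from the left. -/
lemma not_linear_decrease (hk : IsLogConvexKernel ω)
    (hω : (∀ x, 0 < x → 0 < ω x) ∨ ∃ C, ∀ x, 0 < x → ω x ≤ C)
    {g : ℝ → ℝ} (hg : Continuous g) (hg0 : ∀ x, 0 ≤ g x) (hgz : g 0 = 0) {t c : ℝ}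
    (ht : 0 < t) (hc0 : 0 < c)
    (hc : ∀ᶠ h in 𝓝[>] 0, c * h ≤
      (∫ τ in (0:ℝ)..t, ω τ * g τ) - ∫ τ in h..t, ω (τ - h) * g τ) : False := by
  obtain ⟨s, hs, hsub⟩ := mem_nhdsGT_iff_exists_Ioc_subset.1 hc
  have hT : 0 < min s t := lt_min hs ht
  have hc' : ∀ h ∈ Ioc 0 (min s t), c * h ≤
      (∫ τ in (0:ℝ)..min s t, ω τ * g τ) - ∫ τ in h..min s t, ω (τ - h) * g τ := fun h hh =>
    le_trans (hsub ⟨hh.1, hh.2.trans (min_le_left _ _)⟩)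
      (hk.integral_sub_integral_le hg hg0 hh.1.le hh.2 (min_le_right _ _))
  by_cases hb : ∃ C, ∀ x, 0 < x → ω x ≤ C
  · obtain ⟨C, hC⟩ := hb
    exact hk.not_linear_decrease_of_bounded hC hg hg0 hgz hT hc0 hc'
  · have hpos := hω.resolve_right hb
    push Not at hb
    exact hk.not_linear_decrease_of_unbounded hpos hb hg hg0 hgz hT hc0 hc'

end IsLogConvexKernel

section Laplace

variable {μ : Measure ℝ} {ω : ℝ → ℝ}

lemma laplace_antitoneOn
    (hμfin : ∀ t : ℝ, 0 < t →
      Integrable (fun l : ℝ => Real.exp (-l * t)) (μ.restrict (Ici 0)))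
    (hω : ∀ t : ℝ, 0 < t → ω t = ∫ l in Ici (0:ℝ), Real.exp (-l * t) ∂μ) :
    AntitoneOn ω (Ioi 0) := by
  intro x hx y hy hxy
  rw [hω x hx, hω y hy]
  refine setIntegral_mono_on (hμfin y hy) (hμfin x hx) measurableSet_Ici fun l hl => ?_
  exact Real.exp_le_exp.2 (mul_le_mul_of_nonpos_left hxy (neg_nonpos.2 hl))

lemma laplace_nonneg
    (hω : ∀ t : ℝ, 0 < t → ω t = ∫ l in Ici (0:ℝ), Real.exp (-l * t) ∂μ) {x : ℝ} (hx : 0 < x) :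
    0 ≤ ω x := by
  rw [hω x hx]
  exact integral_nonneg fun l => (Real.exp_pos _).le

lemma laplace_quad
    (hμfin : ∀ t : ℝ, 0 < t →
      Integrable (fun l : ℝ => Real.exp (-l * t)) (μ.restrict (Ici 0)))
    (hω : ∀ t : ℝ, 0 < t → ω t = ∫ l in Ici (0:ℝ), Real.exp (-l * t) ∂μ) {x h : ℝ} (hx : 0 < x)
    (hh : 0 < h) (y : ℝ) : 0 ≤ ω x + 2 * y * ω (x + h) + y ^ 2 * ω (x + 2 * h) := by
  have h0 := hμfin x hx
  have h1 := (hμfin (x + h) (by positivity)).const_mul (2 * y)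
  have h2 := (hμfin (x + 2 * h) (by positivity)).const_mul (y ^ 2)
  rw [hω x hx, hω (x + h) (by positivity), hω (x + 2 * h) (by positivity),
    ← integral_const_mul, ← integral_const_mul, ← integral_add h0 h1,
    ← integral_add (by exact h0.add h1) h2]
  refine integral_nonneg fun l => ?_
  have e1 : Real.exp (-l * (x + h)) = Real.exp (-l * x) * Real.exp (-l * h) := by
    rw [← Real.exp_add]; ring_nf
  have e2 : Real.exp (-l * (x + 2 * h)) = Real.exp (-l * x) * Real.exp (-l * h) ^ 2 := by
    rw [← Real.exp_nat_mul, ← Real.exp_add]; push_cast; ring_nf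
  simp only [Pi.zero_apply, e1, e2]
  have : 0 ≤ Real.exp (-l * x) * (1 + y * Real.exp (-l * h)) ^ 2 := by positivity
  linarith

lemma laplace_pos_or_bounded
    (hμfin : ∀ t : ℝ, 0 < t →
      Integrable (fun l : ℝ => Real.exp (-l * t)) (μ.restrict (Ici 0)))
    (hω : ∀ t : ℝ, 0 < t → ω t = ∫ l in Ici (0:ℝ), Real.exp (-l * t) ∂μ) :
    (∀ x, 0 < x → 0 < ω x) ∨ ∃ C, ∀ x, 0 < x → ω x ≤ C := by
  rcases eq_or_ne (μ.restrict (Ici 0)) 0 with h | h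
  · exact .inr ⟨0, fun x hx => by rw [hω x hx, h]; simp⟩
  · have : NeZero (μ.restrict (Ici (0:ℝ))) := ⟨h⟩
    exact .inl fun x hx => by rw [hω x hx]; exact integral_exp_pos (hμfin x hx)

end Laplace

section Convolution

open Filter Topology

lemma intervalIntegrable_of_antitoneOn {ω : ℝ → ℝ} (hanti : AntitoneOn ω (Ioi 0)) {a : ℝ}
    (ha : 0 < a) (h : IntervalIntegrable ω volume 0 a) {T : ℝ} (hT : 0 < T) :
    IntervalIntegrable ω volume 0 T :=
  h.trans (AntitoneOn.intervalIntegrable (hanti.mono fun _ hx =>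
    (lt_min ha hT).trans_le hx.1))

/-- If `ω(r - ·) φ` is integrable up to `r` and `φ r ≠ 0`, then `ω` is integrable at `0`. -/
lemma intervalIntegrable_of_conv {ω φ : ℝ → ℝ} (hanti : AntitoneOn ω (Ioi 0))
    (hφ : Continuous φ) {r : ℝ} (hr : 0 < r) (hφr : φ r ≠ 0)
    (h : IntervalIntegrable (fun s => ω (r - s) * φ s) volume 0 r) {T : ℝ} (hT : 0 < T) :
    IntervalIntegrable ω volume 0 T := by
  have hev : ∀ᶠ s in 𝓝[<] r, φ s ≠ 0 :=
    (hφ.continuousAt.eventually_ne hφr).filter_mono nhdsWithin_le_nhds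
  obtain ⟨l, hl, hsub⟩ := mem_nhdsLT_iff_exists_Ico_subset.1 hev
  set a := max l 0
  have har : a < r := max_lt hl hr
  have hne : ∀ s ∈ uIcc a r, φ s ≠ 0 := by
    intro s hs
    rw [uIcc_of_le har.le] at hs
    rcases hs.2.eq_or_lt with h' | h'
    · rwa [h']
    · exact hsub ⟨(le_max_left _ _).trans hs.1, h'⟩
  have h1 : IntervalIntegrable (fun s => ω (r - s) * φ s) volume a r := h.mono_set (by
    rw [uIcc_of_le har.le, uIcc_of_le hr.le]
    exact Icc_subset_Icc_left (le_max_right _ _))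
  have h2 := h1.mul_continuousOn (hφ.continuousOn.inv₀ hne)
  have h3 : IntervalIntegrable (fun s => ω (r - s)) volume a r :=
    h2.congr fun s hs => by
      simp only [Pi.inv_apply]
      rw [mul_inv_cancel_right₀ (hne s (uIoc_subset_uIcc hs))]
  have h4 := h3.comp_sub_left r
  simp only [sub_sub_cancel, sub_self] at h4
  exact intervalIntegrable_of_antitoneOn hanti (sub_pos.2 har) h4.symm hT

lemma eventually_le_sub_of_hasDerivAt {f : ℝ → ℝ} {d t c : ℝ} (hf : HasDerivAt f d t)
    (hc : c < d) : ∀ᶠ h in 𝓝[>] 0, c * h ≤ f t - f (t - h) := by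
  have h1 : HasDerivAt (fun h => f (t - h)) (-d) 0 := by
    have h2 : HasDerivAt (fun h : ℝ => t - h) (-1) 0 := by
      simpa using (hasDerivAt_id (0:ℝ)).const_sub t
    have := HasDerivAt.comp (0:ℝ) (h₂ := f) (h := fun h => t - h) (by simpa using hf) h2
    simpa [Function.comp_def] using this
  have h3 := (hasDerivAt_iff_tendsto_slope_zero.1 h1).mono_left
    (nhdsWithin_mono 0 (fun x (hx : (0:ℝ) < x) => hx.ne'))
  filter_upwards [h3.eventually_lt_const (neg_lt_neg hc), self_mem_nhdsWithin] with h hh hpos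
  have hpos : 0 < h := hpos
  simp only [zero_add, sub_zero, smul_eq_mul] at hh
  rw [inv_mul_lt_iff₀ hpos] at hh
  linarith

variable {H : Type*} [NormedAddCommGroup H] [InnerProductSpace ℝ H] {ω : ℝ → ℝ} {u : ℝ → H}
  {t : ℝ} {A : ℝ → H} {B : ℝ → ℝ} {A' : H} {B' : ℝ}

lemma IsLogConvexKernel.half_deriv_le_inner [CompleteSpace H] (hk : IsLogConvexKernel ω)
    (hω : (∀ x, 0 < x → 0 < ω x) ∨ ∃ C, ∀ x, 0 < x → ω x ≤ C) (hu : Continuous u) (ht : 0 < t)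
    (hA : ∀ r : ℝ, 0 < r → A r = ∫ s in (0:ℝ)..r, ω (r - s) • u s)
    (hB : ∀ r : ℝ, 0 < r → B r = ∫ s in (0:ℝ)..r, ω (r - s) * ‖u s‖ ^ 2)
    (hA' : HasDerivAt A A' t) (hB' : HasDerivAt B B' t) : (1 / 2) * B' ≤ ⟪u t, A'⟫ := by
  by_contra! hcon
  set v := u t
  have hF : HasDerivAt (fun r => B r - 2 * ⟪v, A r⟫) (B' - 2 * ⟪v, A'⟫) t :=
    hB'.sub (((innerSL ℝ v).hasFDerivAt.comp_hasDerivAt t hA').const_mul 2)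
  have hd : 0 < (B' - 2 * ⟪v, A'⟫) / 2 := by linarith
  have hg : Continuous fun τ => ‖u (t - τ) - v‖ ^ 2 := by fun_prop
  have hΩ : ∀ r, 0 < r → IntervalIntegrable (fun s => ω (r - s)) volume 0 r := fun r hr => by
    simpa using ((hk.int r hr).comp_sub_left r).symm
  have hrep : ∀ h, 0 ≤ h → h < t → B (t - h) - 2 * ⟪v, A (t - h)⟫ =
      (∫ τ in h..t, ω (τ - h) * ‖u (t - τ) - v‖ ^ 2) -
        ‖v‖ ^ 2 * ∫ s in (0:ℝ)..t - h, ω s := by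
    intro h hh hht
    have hr : 0 < t - h := sub_pos.2 hht
    have i0 := hΩ _ hr
    have iA : IntervalIntegrable (fun s => ω (t - h - s) • u s) volume 0 (t - h) :=
      i0.smul_continuousOn hu.continuousOn
    have iB : IntervalIntegrable (fun s => ω (t - h - s) * ‖u s‖ ^ 2) volume 0 (t - h) :=
      i0.mul_continuousOn (by fun_prop)
    have iAi : IntervalIntegrable (fun s => ω (t - h - s) * ⟪v, u s⟫) volume 0 (t - h) :=
      i0.mul_continuousOn (by fun_prop)
    have e1 : ⟪v, A (t - h)⟫ = ∫ s in (0:ℝ)..t - h, ω (t - h - s) * ⟪v, u s⟫ := by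
      rw [hA _ hr]
      have := (innerSL ℝ v).intervalIntegral_comp_comm iA
      simp only [innerSL_apply_apply, real_inner_smul_right] at this
      exact this.symm
    have e2 := intervalIntegral.integral_comp_sub_left (a := h) (b := t)
      (fun s => ω (t - h - s) * ‖u s - v‖ ^ 2) t
    rw [sub_self] at e2
    have e3 : ∀ τ, t - h - (t - τ) = τ - h := fun τ => by ring
    simp only [e3] at e2
    have e4 := intervalIntegral.integral_comp_sub_left (a := 0) (b := t - h) ω (t - h)
    rw [sub_self, sub_zero] at e4
    rw [e1, hB _ hr, e2, ← e4, ← intervalIntegral.integral_const_mul,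
      ← intervalIntegral.integral_const_mul, ← intervalIntegral.integral_sub iB (iAi.const_mul 2),
      ← intervalIntegral.integral_sub (i0.mul_continuousOn (by fun_prop)) (i0.const_mul _)]
    refine intervalIntegral.integral_congr fun s _ => ?_
    simp only [norm_sub_sq_real, real_inner_comm]
    ring
  refine hk.not_linear_decrease hω hg (fun _ => by positivity) (by simp [v]) ht hd ?_
  filter_upwards [eventually_le_sub_of_hasDerivAt hF (half_lt_self (by linarith)),
    Ioo_mem_nhdsGT ht] with h hh hht
  refine hh.trans ?_
  have r0 := hrep 0 le_rfl ht
  have r1 := hrep h hht.1.le hht.2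
  simp only [sub_zero] at r0
  simp only [r0, r1]
  have hmono : ∫ s in (0:ℝ)..t - h, ω s ≤ ∫ s in (0:ℝ)..t, ω s := by
    have h0 : 0 ≤ t - h := (sub_pos.2 hht.2).le
    have hle : t - h ≤ t := by linarith [hht.1]
    rw [← intervalIntegral.integral_add_adjacent_intervals (hk.int' le_rfl h0)
      (hk.int' h0 ht.le)]
    have := intervalIntegral.integral_mono_on_of_le_Ioo hle
      (intervalIntegrable_const (c := (0:ℝ))) (hk.int' h0 ht.le)
      fun x hx => hk.nonneg x (h0.trans_lt hx.1)
    simp only [intervalIntegral.integral_zero] at this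
    linarith
  have := mul_le_mul_of_nonneg_left hmono (sq_nonneg ‖v‖)
  linarith

/-- The convolution inequality when `ω` fails to be integrable at `0`, where the convolutions
take the value `0` at every time at which `u` does not vanish. -/
lemma half_deriv_le_inner_of_not_integrable (hanti : AntitoneOn ω (Ioi 0))
    (hnn : ∀ x, 0 < x → 0 ≤ ω x) (hni : ¬ ∀ T, 0 < T → IntervalIntegrable ω volume 0 T)
    (hu : Continuous u) (ht : 0 < t)
    (hA : ∀ r : ℝ, 0 < r → A r = ∫ s in (0:ℝ)..r, ω (r - s) • u s)
    (hB : ∀ r : ℝ, 0 < r → B r = ∫ s in (0:ℝ)..r, ω (r - s) * ‖u s‖ ^ 2)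
    (hA' : HasDerivAt A A' t) (hB' : HasDerivAt B B' t) : (1 / 2) * B' ≤ ⟪u t, A'⟫ := by
  have hBz : ∀ r, 0 < r → u r ≠ 0 → B r = 0 := fun r hr hur => by
    rw [hB r hr]
    exact intervalIntegral.integral_undef fun h => hni fun T hT =>
      intervalIntegrable_of_conv hanti (φ := fun s => ‖u s‖ ^ 2) (by fun_prop) hr
        (by simpa using hur) h hT
  have hAz : ∀ r, 0 < r → u r ≠ 0 → A r = 0 := fun r hr hur => by
    rw [hA r hr]
    refine intervalIntegral.integral_undef fun h => hni fun T hT =>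
      intervalIntegrable_of_conv hanti (φ := fun s => ⟪u r, u s⟫) (by fun_prop) hr
        (by simpa using hur) ?_ hT
    have h1 : IntervalIntegrable (fun s => innerSL ℝ (u r) (ω (r - s) • u s)) volume 0 r :=
      ⟨(innerSL ℝ (u r)).integrable_comp h.1, (innerSL ℝ (u r)).integrable_comp h.2⟩
    simpa only [innerSL_apply_apply, real_inner_smul_right] using h1
  have hBnn : ∀ r, 0 < r → 0 ≤ B r := fun r hr => by
    rw [hB r hr, intervalIntegral.integral_of_le hr.le, integral_Ioc_eq_integral_Ioo]
    exact setIntegral_nonneg measurableSet_Ioo fun s hs =>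
      mul_nonneg (hnn _ (sub_pos.2 hs.2)) (sq_nonneg _)
  have hin : ⟪u t, A'⟫ = 0 := by
    by_cases hut : u t = 0
    · rw [hut, inner_zero_left]
    · have hev : A =ᶠ[𝓝 t] fun _ => 0 := by
        filter_upwards [hu.continuousAt.eventually_ne hut, lt_mem_nhds ht] with r h1 h2
        exact hAz r h2 h1
      rw [hA'.unique ((hasDerivAt_const t (0:H)).congr_of_eventuallyEq hev), inner_zero_right]
  suffices hB0 : B' ≤ 0 by rw [hin]; linarith
  by_contra! hpos
  have hev := eventually_le_sub_of_hasDerivAt hB' (half_lt_self hpos)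
  obtain ⟨h₀, hh₀, hlt⟩ := (hev.and (Ioo_mem_nhdsGT ht : ∀ᶠ h in 𝓝[>] (0:ℝ), h ∈ Ioo 0 t)).exists
  have hBt : 0 < B t := by
    have := hBnn (t - h₀) (sub_pos.2 hlt.2)
    have := mul_pos (half_pos hpos) hlt.1
    linarith
  have hu0 : ∀ᶠ r in 𝓝 t, B r ≠ 0 ∧ u r = 0 := by
    filter_upwards [hB'.continuousAt.eventually_ne hBt.ne', lt_mem_nhds ht] with r h1 h2
    exact ⟨h1, by_contra fun h => h1 (hBz r h2 h)⟩
  obtain ⟨ρ, hρ, hball⟩ := Metric.eventually_nhds_iff.1 hu0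
  have hevt : ∀ᶠ h in 𝓝[>] (0:ℝ), h ∈ Ioo 0 t := Ioo_mem_nhdsGT ht
  have hevρ : ∀ᶠ h in 𝓝[>] (0:ℝ), h ∈ Ioo 0 ρ := Ioo_mem_nhdsGT hρ
  obtain ⟨h, hh, hht, hhρ⟩ := (hev.and (hevt.and hevρ)).exists
  have hr : 0 < t - h := sub_pos.2 hht.2
  have hnear : ∀ s ∈ Icc (t - h) t, B s ≠ 0 ∧ u s = 0 := fun s hs => hball (by
    rw [Real.dist_eq, abs_lt]; constructor <;> linarith [hs.1, hs.2, hhρ.2])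
  have hωi : ∀ r, 0 < r → B r ≠ 0 →
      IntervalIntegrable (fun s => ω (r - s) * ‖u s‖ ^ 2) volume 0 r := fun r hr hr0 => by
    by_contra hc
    exact hr0 ((hB r hr).trans (intervalIntegral.integral_undef hc))
  have it := hωi t ht hBt.ne'
  have i1 := hωi (t - h) hr (hnear _ ⟨le_rfl, by linarith [hht.1]⟩).1
  have hsub1 : uIcc 0 (t - h) ⊆ uIcc 0 t := by
    rw [uIcc_of_le hr.le, uIcc_of_le ht.le]; exact Icc_subset_Icc_right (by linarith [hht.1])
  have hsub2 : uIcc (t - h) t ⊆ uIcc 0 t := by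
    rw [uIcc_of_le (by linarith [hht.1]), uIcc_of_le ht.le]; exact Icc_subset_Icc_left hr.le
  have hle : B t ≤ B (t - h) := by
    rw [hB t ht, hB _ hr, ← intervalIntegral.integral_add_adjacent_intervals
      (it.mono_set hsub1) (it.mono_set hsub2)]
    have hz : ∫ s in (t - h)..t, ω (t - s) * ‖u s‖ ^ 2 = ∫ _ in (t - h)..t, (0:ℝ) :=
      intervalIntegral.integral_congr fun s hs => by
        rw [uIcc_of_le (by linarith [hht.1])] at hs
        simp [(hnear s hs).2]
    rw [hz, intervalIntegral.integral_zero, add_zero]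
    refine intervalIntegral.integral_mono_on_of_le_Ioo hr.le (it.mono_set hsub1) i1 fun s hs => ?_
    refine mul_le_mul_of_nonneg_right (hanti ?_ ?_ ?_) (sq_nonneg _)
    · exact mem_Ioi.2 (by linarith [hs.2])
    · exact mem_Ioi.2 (by linarith [hs.2, hht.1])
    · linarith [hht.1]
  have := mul_pos (half_pos hpos) hht.1
  linarith

end Convolution

/-- Hilbert-space version of the convolution inequality for a Bernstein kernel:
`⟨u t, A' t⟩ ≥ (1/2) B' t` where `A t = ∫_0^t ω (t-s) • u s ds` (Bochner)
and `B t = ∫_0^t ω (t-s) ‖u s‖² ds`. -/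
theorem stmt2 {H : Type*} [NormedAddCommGroup H] [InnerProductSpace ℝ H]
    [CompleteSpace H]
    (μ : Measure ℝ)
    (hμfin : ∀ t : ℝ, 0 < t →
      Integrable (fun l : ℝ => Real.exp (-l * t)) (μ.restrict (Ici 0)))
    (ω : ℝ → ℝ)
    (hω : ∀ t : ℝ, 0 < t → ω t = ∫ l in Ici (0:ℝ), Real.exp (-l * t) ∂μ)
    (u : ℝ → H) (hu : ContinuousOn u (Ici 0))
    (hub : ∃ M : ℝ, ∀ s ∈ Ici (0:ℝ), ‖u s‖ ≤ M)
    (t : ℝ) (ht : 0 < t)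
    (A : ℝ → H) (B : ℝ → ℝ)
    (hA : ∀ r : ℝ, 0 < r → A r = ∫ s in (0:ℝ)..r, ω (r - s) • u s)
    (hB : ∀ r : ℝ, 0 < r → B r = ∫ s in (0:ℝ)..r, ω (r - s) * ‖u s‖ ^ 2)
    (A' : H) (B' : ℝ) (hA' : HasDerivAt A A' t) (hB' : HasDerivAt B B' t) :
    ⟪u t, A'⟫ ≥ (1 / 2) * B' := by
  have hanti := laplace_antitoneOn hμfin hω
  have hnn : ∀ x, 0 < x → 0 ≤ ω x := fun x hx => laplace_nonneg hω hx
  set U : ℝ → H := fun s => u (max s 0)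
  have hU : Continuous U :=
    hu.comp_continuous (by fun_prop) fun s => mem_Ici.2 (le_max_right s 0)
  have hUu : ∀ s, 0 ≤ s → U s = u s := fun s hs => by simp only [U, max_eq_left hs]
  have hAU : ∀ r : ℝ, 0 < r → A r = ∫ s in (0:ℝ)..r, ω (r - s) • U s := fun r hr => by
    rw [hA r hr]
    refine intervalIntegral.integral_congr fun s hs => ?_
    rw [uIcc_of_le hr.le] at hs
    simp only [hUu s hs.1]
  have hBU : ∀ r : ℝ, 0 < r → B r = ∫ s in (0:ℝ)..r, ω (r - s) * ‖U s‖ ^ 2 := fun r hr => by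
    rw [hB r hr]
    refine intervalIntegral.integral_congr fun s hs => ?_
    rw [uIcc_of_le hr.le] at hs
    simp only [hUu s hs.1]
  rw [ge_iff_le, ← hUu t ht.le]
  by_cases hωi : ∀ T, 0 < T → IntervalIntegrable ω volume 0 T
  · exact IsLogConvexKernel.half_deriv_le_inner
      ⟨hanti, hnn, hωi, fun x hx h hh y => laplace_quad hμfin hω hx hh y⟩
      (laplace_pos_or_bounded hμfin hω) hU ht hAU hBU hA' hB'
  · exact half_deriv_le_inner_of_not_integrable hanti hnn hωi hU ht hAU hBU hA' hB'
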